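/- arXiv:2401.04676 — 5 statements merged into one kernel-verified Lean document; each statement's English description precedes it below -/
import Mathlib

section
/- Let F be a field and let A = F⟨x_1,…,x_d⟩/⟨P_1,…,P_r⟩ be a finitely presented rank-stable F-algebra. Suppose A is linear sofic, i.e., there exist a sequence of positive integers (n_k)_{k≥1}, a non-principal ultrafilter 𝒰 on ℕ, and an injective F-algebra homomorphism Φ from A into the metric ultraproduct ∏_{k→𝒰} M_{n_k}(F)/ker(ρ_𝒰), where ρ_𝒰 : ∏_k M_{n_k}(F) → [0,1] is defined by ρ_𝒰((A_k)_k) = lim_{k→𝒰} rank(A_k) and ker(ρ_𝒰) is the two-sided ideal of sequences on which ρ_𝒰 vanishes. Then A is residually finite-dimensional: for every nonzero a ∈ A there exist n ≥ 1 and an F-algebra homomorphism f : A → M_n(F) with f(a) ≠ 0. -/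
open Matrix

noncomputable section

/-- Zero-padding of a square matrix to size `m` (the ℕ×ℕ extension `Â`, clipped to size `m`). -/
def padTo {F : Type} [Zero F] {n : ℕ} (m : ℕ) (A : Matrix (Fin n) (Fin n) F) :
    Matrix (Fin m) (Fin m) F :=
  Matrix.of fun i j =>
    if h : (i : ℕ) < n ∧ (j : ℕ) < n then A ⟨i, h.1⟩ ⟨j, h.2⟩ else 0

/-- `Rank(Â − B̂)` for `A ∈ M_n(F)` and `B ∈ M_{n'}(F)`. -/
def padRankDiff {F : Type} [Field F] {n n' : ℕ} (A : Matrix (Fin n) (Fin n) F)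
    (B : Matrix (Fin n') (Fin n') F) : ℕ :=
  (padTo (max n n') A - padTo (max n n') B).rank

/-- Evaluation of a noncommutative polynomial `P ∈ F⟨x_s : s ∈ σ⟩` at a tuple of matrices,
where scalar terms are interpreted as scalar matrices. -/
def evalPoly {F : Type} [Field F] {σ : Type} {n : ℕ}
    (P : FreeAlgebra F σ) (A : σ → Matrix (Fin n) (Fin n) F) :
    Matrix (Fin n) (Fin n) F :=
  FreeAlgebra.lift F A P

/-- Rank-stability of the presentation `F⟨x_s : s ∈ σ⟩ / ⟨P_i : i ∈ ι⟩`. -/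
def RankStable (F : Type) [Field F] {σ ι : Type} (P : ι → FreeAlgebra F σ) : Prop :=
  ∀ ε : ℝ, 0 < ε → ∃ δ : ℝ, 0 < δ ∧
    ∀ n : ℕ, 0 < n → ∀ A : σ → Matrix (Fin n) (Fin n) F,
      (∀ i, ((evalPoly (P i) A).rank : ℝ) < δ * n) →
      ∃ n' : ℕ, 0 < n' ∧ ∃ B : σ → Matrix (Fin n') (Fin n') F,
        (∀ i, evalPoly (P i) B = 0) ∧
        ∀ j, ((padRankDiff (A j) (B j) : ℝ) < ε * n)

section Rank

variable {K : Type*} [Field K] {m n : Type*} [Fintype n]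

theorem Matrix.rank_add_le_rank_add_rank [Finite m] (X Y : Matrix m n K) :
    (X + Y).rank ≤ X.rank + Y.rank := by
  rw [Matrix.rank, Matrix.mulVecLin_add]
  refine (Submodule.finrank_mono (LinearMap.range_add_le _ _)).trans ?_
  exact Submodule.finrank_add_le_finrank_add_finrank _ _

theorem Matrix.rank_neg_eq (X : Matrix m n K) : (-X).rank = X.rank := by
  rw [← neg_one_smul K X]
  exact Matrix.rank_smul_of_mem_nonZeroDivisors X (mem_nonZeroDivisors_of_ne_zero (by simp))

theorem Matrix.rank_smul_le_rank (c : K) (X : Matrix m n K) : (c • X).rank ≤ X.rank := by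
  rcases eq_or_ne c 0 with rfl | hc
  · simp
  · exact (Matrix.rank_smul_of_mem_nonZeroDivisors X (mem_nonZeroDivisors_of_ne_zero hc)).le

theorem Matrix.rank_sub_le_rank_add_rank [Finite m] (X Y : Matrix m n K) :
    (X - Y).rank ≤ X.rank + Y.rank := by
  rw [sub_eq_add_neg, ← Matrix.rank_neg_eq Y]
  exact Matrix.rank_add_le_rank_add_rank X (-Y)

theorem Matrix.rank_mul_sub_mul_le [DecidableEq n] (X Y X' Y' : Matrix n n K) :
    (X * Y - X' * Y').rank ≤ (X - X').rank + (Y - Y').rank := by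
  have h : X * Y - X' * Y' = (X - X') * Y + X' * (Y - Y') := by noncomm_ring
  rw [h]
  refine (Matrix.rank_add_le_rank_add_rank _ _).trans ?_
  gcongr
  · exact Matrix.rank_mul_le_left _ _
  · exact Matrix.rank_mul_le_right _ _

theorem Matrix.rank_mul_mul_le {l o : Type*} [Fintype m] [Fintype o]
    (E : Matrix l m K) (X : Matrix m n K) (G : Matrix n o K) :
    (E * X * G).rank ≤ X.rank :=
  (Matrix.rank_mul_le_left _ _).trans (Matrix.rank_mul_le_right _ _)

theorem Matrix.rank_conjugate [Fintype m] [DecidableEq n]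
    {E : Matrix m n K} (hE : Eᵀ * E = 1) (X : Matrix n n K) :
    (E * X * Eᵀ).rank = X.rank := by
  refine le_antisymm (Matrix.rank_mul_mul_le _ _ _) ?_
  have h : X = Eᵀ * (E * X * Eᵀ) * E := by
    calc X = (Eᵀ * E) * X * (Eᵀ * E) := by simp [hE]
      _ = _ := by simp only [Matrix.mul_assoc]
  conv_lhs => rw [h]
  exact Matrix.rank_mul_mul_le _ _ _

end Rank

section Padding

variable {F : Type} [Field F]

/-- The matrix of the inclusion of the first `n` coordinates. -/
def padIncl (F : Type) [Field F] (m n : ℕ) : Matrix (Fin m) (Fin n) F :=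
  Matrix.of fun i j => if (i : ℕ) = j then 1 else 0

theorem padIncl_transpose_mul_self {m n : ℕ} (h : n ≤ m) :
    (padIncl F m n)ᵀ * padIncl F m n = 1 := by
  ext i j
  simp only [padIncl, Matrix.mul_apply, Matrix.transpose_apply, Matrix.of_apply]
  rw [Finset.sum_eq_single (Fin.castLE h i)]
  · simp [Matrix.one_apply, Fin.ext_iff]
  · intro b _ hb
    have : (b : ℕ) ≠ i := fun h' => hb (Fin.ext h')
    simp [this]
  · simp

theorem padTo_eq_conjugate {m n : ℕ} (X : Matrix (Fin n) (Fin n) F) :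
    padTo m X = padIncl F m n * X * (padIncl F m n)ᵀ := by
  have hleft : ∀ (i : Fin m) (j : Fin n),
      (padIncl F m n * X) i j = if h : (i : ℕ) < n then X ⟨i, h⟩ j else 0 := by
    intro i j
    simp only [padIncl, Matrix.mul_apply, Matrix.of_apply, ite_mul, one_mul, zero_mul]
    split_ifs with h
    · rw [Finset.sum_eq_single ⟨i, h⟩]
      · simp
      · intro b _ hb
        have : (i : ℕ) ≠ b := fun h' => hb (Fin.ext h'.symm)
        simp [this]
      · simp
    · refine Finset.sum_eq_zero fun b _ => if_neg ?_
      have := b.2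
      omega
  ext i j
  rw [Matrix.mul_apply]
  simp only [hleft]
  simp only [padTo, Matrix.of_apply, Matrix.transpose_apply, padIncl, mul_ite, mul_one, mul_zero]
  by_cases hj : (j : ℕ) < n
  · rw [Finset.sum_eq_single ⟨j, hj⟩]
    · by_cases hi : (i : ℕ) < n <;> simp [hi, hj]
    · intro b _ hb
      have : (j : ℕ) ≠ b := fun h' => hb (Fin.ext h'.symm)
      simp [this]
    · simp
  · rw [dif_neg fun h => hj h.2]
    refine (Finset.sum_eq_zero fun b _ => if_neg ?_).symm
    have := b.2
    omega

end Padding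

section Eval

variable {F : Type} [Field F] {σ : Type}

/-- The constant term of a noncommutative polynomial. -/
def constTerm : FreeAlgebra F σ →ₐ[F] F := FreeAlgebra.lift F 0

theorem evalPoly_conjugate {m n : ℕ} {E : Matrix (Fin m) (Fin n) F} (hE : Eᵀ * E = 1)
    (x : FreeAlgebra F σ) (X : σ → Matrix (Fin n) (Fin n) F) :
    evalPoly x (fun j => E * X j * Eᵀ) =
      E * evalPoly x X * Eᵀ + constTerm x • (1 - E * Eᵀ) := by
  induction x using FreeAlgebra.induction with
  | grade0 c =>
    simp [evalPoly, Algebra.algebraMap_eq_smul_one, smul_sub]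
  | grade1 j => simp [evalPoly, constTerm]
  | add a b ha hb =>
    simp only [evalPoly, map_add] at ha hb ⊢
    rw [ha, hb, Matrix.mul_add, Matrix.add_mul, add_smul]
    abel
  | mul a b ha hb =>
    simp only [evalPoly, map_mul] at ha hb ⊢
    rw [ha, hb]
    generalize (FreeAlgebra.lift F X) a = S
    generalize (FreeAlgebra.lift F X) b = T
    have h1 : E * S * Eᵀ * (E * T * Eᵀ) = E * (S * T) * Eᵀ := by
      calc _ = E * S * (Eᵀ * E) * T * Eᵀ := by simp only [Matrix.mul_assoc]
        _ = _ := by rw [hE]; simp only [Matrix.mul_assoc, Matrix.one_mul]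
    have h2 : Eᵀ * (1 - E * Eᵀ) = 0 := by
      rw [Matrix.mul_sub, ← Matrix.mul_assoc, hE]; simp
    have h3 : (1 - E * Eᵀ) * E = 0 := by
      rw [Matrix.sub_mul, Matrix.mul_assoc, hE]; simp
    have h4 : (1 - E * Eᵀ) * (1 - E * Eᵀ) = 1 - E * Eᵀ := by
      conv_lhs => rw [Matrix.mul_sub, ← Matrix.mul_assoc, h3]
      simp
    have h5 : E * S * Eᵀ * (1 - E * Eᵀ) = 0 := by rw [Matrix.mul_assoc, h2, Matrix.mul_zero]
    have h6 : (1 - E * Eᵀ) * (E * T * Eᵀ) = 0 := by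
      rw [← Matrix.mul_assoc, ← Matrix.mul_assoc, h3, Matrix.zero_mul, Matrix.zero_mul]
    rw [Matrix.add_mul, Matrix.mul_add, Matrix.mul_add, h1, Matrix.mul_smul, Matrix.smul_mul,
      Matrix.smul_mul, Matrix.mul_smul, h4, h5, h6, smul_smul]
    simp

theorem evalPoly_padTo {m n : ℕ} (h : n ≤ m) (x : FreeAlgebra F σ)
    (X : σ → Matrix (Fin n) (Fin n) F) :
    evalPoly x (fun j => padTo m (X j)) =
      padTo m (evalPoly x X) + constTerm x • (1 - padTo m (1 : Matrix (Fin n) (Fin n) F)) := by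
  simp only [padTo_eq_conjugate, Matrix.mul_one]
  exact evalPoly_conjugate (padIncl_transpose_mul_self h) x X

theorem rank_padTo {m n : ℕ} (h : n ≤ m) (X : Matrix (Fin n) (Fin n) F) :
    (padTo m X).rank = X.rank := by
  rw [padTo_eq_conjugate, Matrix.rank_conjugate (padIncl_transpose_mul_self h)]

theorem exists_rank_evalPoly_sub_le (x : FreeAlgebra F σ) :
    ∃ C : ℕ, ∀ (n : ℕ) (X Y : σ → Matrix (Fin n) (Fin n) F) (t : ℝ), 0 ≤ t →
      (∀ j, ((X j - Y j).rank : ℝ) ≤ t) →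
      ((evalPoly x X - evalPoly x Y).rank : ℝ) ≤ C * t := by
  induction x using FreeAlgebra.induction with
  | grade0 c => exact ⟨0, fun n X Y t ht h => by simp [evalPoly]⟩
  | grade1 j => exact ⟨1, fun n X Y t ht h => by simpa [evalPoly] using h j⟩
  | add a b ha hb =>
    obtain ⟨C, hC⟩ := ha
    obtain ⟨D, hD⟩ := hb
    refine ⟨C + D, fun n X Y t ht h => ?_⟩
    have h1 := hC n X Y t ht h
    have h2 := hD n X Y t ht h
    simp only [evalPoly, map_add] at h1 h2 ⊢
    rw [add_sub_add_comm]
    have h3 := Matrix.rank_add_le_rank_add_rank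
      (FreeAlgebra.lift F X a - FreeAlgebra.lift F Y a)
      (FreeAlgebra.lift F X b - FreeAlgebra.lift F Y b)
    have h3' : (_ : ℝ) ≤ _ := Nat.cast_le.mpr h3
    push_cast at h3' ⊢
    linarith
  | mul a b ha hb =>
    obtain ⟨C, hC⟩ := ha
    obtain ⟨D, hD⟩ := hb
    refine ⟨C + D, fun n X Y t ht h => ?_⟩
    have h1 := hC n X Y t ht h
    have h2 := hD n X Y t ht h
    simp only [evalPoly, map_mul] at h1 h2 ⊢
    have h3 := Matrix.rank_mul_sub_mul_le (FreeAlgebra.lift F X a) (FreeAlgebra.lift F X b)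
      (FreeAlgebra.lift F Y a) (FreeAlgebra.lift F Y b)
    have h3' : (_ : ℝ) ≤ _ := Nat.cast_le.mpr h3
    push_cast at h3' ⊢
    linarith

/-- Without a constant term, padding does not affect the value of a polynomial, so that the rank at
`X` is controlled by the padded distance from `X` to a zero `Y`. -/
theorem exists_rank_evalPoly_le {x : FreeAlgebra F σ} (hx : constTerm x = 0) :
    ∃ C : ℕ, ∀ (n n' : ℕ) (X : σ → Matrix (Fin n) (Fin n) F)
      (Y : σ → Matrix (Fin n') (Fin n') F) (t : ℝ), 0 ≤ t →
      (∀ j, (padRankDiff (X j) (Y j) : ℝ) ≤ t) → evalPoly x Y = 0 →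
      ((evalPoly x X).rank : ℝ) ≤ C * t := by
  obtain ⟨C, hC⟩ := exists_rank_evalPoly_sub_le x
  refine ⟨C, fun n n' X Y t ht h hY => ?_⟩
  have h1 := hC _ (fun j => padTo (max n n') (X j)) (fun j => padTo (max n n') (Y j)) t ht h
  rw [evalPoly_padTo (le_max_left _ _), evalPoly_padTo (le_max_right _ _), hY, hx,
    padTo_eq_conjugate (0 : Matrix (Fin n') (Fin n') F)] at h1
  simpa [rank_padTo] using h1

theorem evalPoly_zero {n : ℕ} (x : FreeAlgebra F σ) :
    evalPoly x (0 : σ → Matrix (Fin n) (Fin n) F) = algebraMap F _ (constTerm x) := by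
  have h : FreeAlgebra.lift F (0 : σ → Matrix (Fin n) (Fin n) F) =
      (Algebra.ofId F _).comp constTerm := by
    ext j : 2
    simp [constTerm]
  exact DFunLike.congr_fun h x

end Eval

section Presentation

variable {F : Type} [Field F] {σ ι A : Type} [Ring A] [Algebra F A]
  {P : ι → FreeAlgebra F σ} {π : FreeAlgebra F σ →ₐ[F] A}

theorem exists_algHom_of_evalPoly_eq_zero (hπ : Function.Surjective π)
    (hker : ∀ x, π x = 0 → x ∈ TwoSidedIdeal.span (Set.range P)) {n : ℕ}
    {B : σ → Matrix (Fin n) (Fin n) F} (hB : ∀ i, evalPoly (P i) B = 0) :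
    ∃ f : A →ₐ[F] Matrix (Fin n) (Fin n) F, ∀ x, f (π x) = evalPoly x B := by
  have hspan : TwoSidedIdeal.span (Set.range P) ≤ TwoSidedIdeal.ker (FreeAlgebra.lift F B) := by
    rw [TwoSidedIdeal.span_le]
    rintro _ ⟨i, rfl⟩
    exact (TwoSidedIdeal.mem_ker _).mpr (hB i)
  have hle : RingHom.ker (π : FreeAlgebra F σ →+* A) ≤
      RingHom.ker (FreeAlgebra.lift F B : FreeAlgebra F σ →+* Matrix (Fin n) (Fin n) F) :=
    fun x hx => (TwoSidedIdeal.mem_ker _).mp (hspan (hker x hx))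
  let g := RingHom.liftOfSurjective (π : FreeAlgebra F σ →+* A) hπ ⟨_, hle⟩
  have hg : ∀ x, g (π x) = evalPoly x B := fun x =>
    RingHom.liftOfRightInverse_comp_apply (π : FreeAlgebra F σ →+* A) _ _ ⟨_, hle⟩ x
  refine ⟨{ g with commutes' := fun c => ?_ }, hg⟩
  change g (algebraMap F A c) = _
  rw [← π.commutes c, hg]
  exact (FreeAlgebra.lift F B).commutes c

/-- An element killed by all finite-dimensional representations has a representative without
constant term: either some relation has a constant term, which can be used to remove that of the
representative, or evaluation at `0` is a representation, which annihilates it. -/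
theorem exists_constTerm_eq_zero (hπ : Function.Surjective π)
    (hker : ∀ x, π x = 0 ↔ x ∈ TwoSidedIdeal.span (Set.range P)) {a : A}
    (ha : ∀ n : ℕ, 0 < n → ∀ f : A →ₐ[F] Matrix (Fin n) (Fin n) F, f a = 0) :
    ∃ x, π x = a ∧ constTerm x = 0 := by
  obtain ⟨x, rfl⟩ := hπ a
  by_cases h : ∃ i, constTerm (P i) ≠ 0
  · obtain ⟨i, hi⟩ := h
    have hPi : π (P i) = 0 := (hker _).mpr (TwoSidedIdeal.subset_span ⟨i, rfl⟩)
    refine ⟨x - (constTerm x / constTerm (P i)) • P i, ?_, ?_⟩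
    · rw [map_sub, map_smul, hPi, smul_zero, sub_zero]
    · rw [map_sub, map_smul, smul_eq_mul, div_mul_cancel₀ _ hi, sub_self]
  · push Not at h
    refine ⟨x, rfl, ?_⟩
    obtain ⟨f, hf⟩ := exists_algHom_of_evalPoly_eq_zero hπ (fun x => (hker x).mp)
      (B := (0 : σ → Matrix (Fin 1) (Fin 1) F)) fun i => by rw [evalPoly_zero, h, map_zero]
    have h0 := hf x
    rw [ha 1 one_pos f, evalPoly_zero] at h0
    exact (map_eq_zero _).mp h0.symm

theorem tendsto_rank_sub_evalPoly {κ : Type*} {l : Filter κ} {N : κ → ℕ}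
    (φ : A → ∀ k, Matrix (Fin (N k)) (Fin (N k)) F)
    (hadd : ∀ a b : A, Filter.Tendsto
      (fun k => (((φ (a + b) - φ a - φ b) k).rank : ℝ) / N k) l (nhds 0))
    (hmul : ∀ a b : A, Filter.Tendsto
      (fun k => (((φ (a * b) - φ a * φ b) k).rank : ℝ) / N k) l (nhds 0))
    (halg : ∀ c : F, Filter.Tendsto
      (fun k => (((φ (algebraMap F A c)
        - algebraMap F (∀ k, Matrix (Fin (N k)) (Fin (N k)) F) c) k).rank : ℝ) / N k)
      l (nhds 0))
    (x : FreeAlgebra F σ) :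
    Filter.Tendsto (fun k => ((φ (π x) k -
      evalPoly x fun j => φ (π (FreeAlgebra.ι F j)) k).rank : ℝ) / N k) l (nhds 0) := by
  induction x using FreeAlgebra.induction with
  | grade0 c => simpa [evalPoly] using halg c
  | grade1 j => simpa [evalPoly] using tendsto_const_nhds
  | add a b ha hb =>
    refine squeeze_zero (fun k => by positivity) (fun k => ?_)
      (by simpa using ((hadd (π a) (π b)).add ha).add hb)
    rw [← add_div, ← add_div]
    gcongr
    norm_cast
    simp only [evalPoly, map_add]
    set S := FreeAlgebra.lift F (fun j => φ (π (FreeAlgebra.ι F j)) k) a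
    set T := FreeAlgebra.lift F (fun j => φ (π (FreeAlgebra.ι F j)) k) b
    have h : φ (π a + π b) k - (S + T) = (φ (π a + π b) k - φ (π a) k - φ (π b) k) +
      (φ (π a) k - S) + (φ (π b) k - T) := by abel
    rw [h]
    refine (Matrix.rank_add_le_rank_add_rank _ _).trans ?_
    gcongr
    exact Matrix.rank_add_le_rank_add_rank _ _
  | mul a b ha hb =>
    refine squeeze_zero (fun k => by positivity) (fun k => ?_)
      (by simpa using (hmul (π a) (π b)).add (ha.add hb))
    rw [← add_div, ← add_div]
    gcongr
    norm_cast
    simp only [evalPoly, map_mul]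
    set S := FreeAlgebra.lift F (fun j => φ (π (FreeAlgebra.ι F j)) k) a
    set T := FreeAlgebra.lift F (fun j => φ (π (FreeAlgebra.ι F j)) k) b
    rw [← sub_add_sub_cancel _ (φ (π a) k * φ (π b) k) (S * T)]
    refine (Matrix.rank_add_le_rank_add_rank _ _).trans ?_
    gcongr
    exact Matrix.rank_mul_sub_mul_le _ _ _ _

end Presentation

/-- **Linear sofic + rank-stable ⟹ residually finite-dimensional.** Let
`A = F⟨x_1,…,x_d⟩/⟨P_1,…,P_r⟩` be a finitely presented rank-stable algebra which is linear
sofic: there are sizes `n_k ≥ 1`, a non-principal ultrafilter `𝒰` on `ℕ`, and a map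
`φ : A → Π_k M_{n_k}(F)` which is an `F`-algebra homomorphism modulo the ideal
`ker ρ_𝒰 = {x ∣ lim_{k→𝒰} rank(x_k)/n_k = 0}` and is injective modulo that ideal
(i.e. `φ` represents an injective `F`-algebra homomorphism into the metric ultraproduct
`∏_{k→𝒰} M_{n_k}(F)/ker ρ_𝒰`). Then `A` is residually finite-dimensional. -/
theorem stmt9_linear_sofic_rank_stable_implies_residually_finite_dimensional
    (F : Type) [Field F] (d r : ℕ)
    (P : Fin r → FreeAlgebra F (Fin d))
    (A : Type) [Ring A] [Algebra F A]
    (π : FreeAlgebra F (Fin d) →ₐ[F] A)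
    (hπ : Function.Surjective π)
    (hker : ∀ x, π x = 0 ↔ x ∈ TwoSidedIdeal.span (Set.range P))
    (hstable : RankStable F P)
    (nk : ℕ → ℕ) (hnk : ∀ k, 0 < nk k)
    (𝒰 : Ultrafilter ℕ) (h𝒰 : ∀ a : ℕ, 𝒰 ≠ (pure a : Ultrafilter ℕ))
    (φ : A → ∀ k, Matrix (Fin (nk k)) (Fin (nk k)) F)
    (hadd : ∀ a b : A, Filter.Tendsto
      (fun k => (((φ (a + b) - φ a - φ b) k).rank : ℝ) / nk k) (𝒰 : Filter ℕ) (nhds 0))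
    (hmul : ∀ a b : A, Filter.Tendsto
      (fun k => (((φ (a * b) - φ a * φ b) k).rank : ℝ) / nk k) (𝒰 : Filter ℕ) (nhds 0))
    (halg : ∀ c : F, Filter.Tendsto
      (fun k => (((φ (algebraMap F A c)
        - algebraMap F (∀ k, Matrix (Fin (nk k)) (Fin (nk k)) F) c) k).rank : ℝ) / nk k)
      (𝒰 : Filter ℕ) (nhds 0))
    (hinj : ∀ a : A, a ≠ 0 → ¬ Filter.Tendsto
      (fun k => ((φ a k).rank : ℝ) / nk k) (𝒰 : Filter ℕ) (nhds 0)) :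
    ∀ a : A, a ≠ 0 → ∃ n : ℕ, 0 < n ∧
      ∃ f : A →ₐ[F] Matrix (Fin n) (Fin n) F, f a ≠ 0 := by
  intro a ha
  by_contra! hno
  obtain ⟨x, rfl, hx⟩ := exists_constTerm_eq_zero hπ hker hno
  have happrox := tendsto_rank_sub_evalPoly (π := π) φ hadd hmul halg
  obtain ⟨C, hC⟩ := exists_rank_evalPoly_le hx
  set X : ∀ k, Fin d → Matrix (Fin (nk k)) (Fin (nk k)) F :=
    fun k j => φ (π (FreeAlgebra.ι F j)) k
  have hφ0 : Filter.Tendsto (fun k => ((φ 0 k).rank : ℝ) / nk k) (𝒰 : Filter ℕ) (nhds 0) := by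
    simpa using halg 0
  have hP : ∀ i, Filter.Tendsto (fun k => ((evalPoly (P i) (X k)).rank : ℝ) / nk k)
      (𝒰 : Filter ℕ) (nhds 0) := by
    intro i
    refine squeeze_zero (fun k => by positivity) (fun k => ?_)
      (by simpa using hφ0.add (happrox (P i)))
    rw [← add_div]
    gcongr
    norm_cast
    rw [(hker _).mpr (TwoSidedIdeal.subset_span ⟨i, rfl⟩)]
    simpa using Matrix.rank_sub_le_rank_add_rank (φ 0 k) (φ 0 k - evalPoly (P i) (X k))
  have hxX : Filter.Tendsto (fun k => ((evalPoly x (X k)).rank : ℝ) / nk k)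
      (𝒰 : Filter ℕ) (nhds 0) := by
    rw [Metric.tendsto_nhds]
    intro η hη
    obtain ⟨δ, hδ, hstab⟩ := hstable (η / (C + 1)) (by positivity)
    have hev : ∀ᶠ k in (𝒰 : Filter ℕ), ∀ i, ((evalPoly (P i) (X k)).rank : ℝ) / nk k < δ :=
      Filter.eventually_all.mpr fun i => (hP i).eventually_lt_const hδ
    filter_upwards [hev] with k hk
    have hn : (0 : ℝ) < nk k := Nat.cast_pos.mpr (hnk k)
    obtain ⟨n', hn', B, hB, hXB⟩ := hstab (nk k) (hnk k) (X k) fun i => (div_lt_iff₀ hn).mp (hk i)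
    obtain ⟨f, hf⟩ := exists_algHom_of_evalPoly_eq_zero hπ (fun x => (hker x).mp) hB
    have hle := hC (nk k) n' (X k) B (η / (C + 1) * nk k) (by positivity)
      (fun j => (hXB j).le) (by rw [← hf, hno n' hn' f])
    rw [Real.dist_eq, sub_zero, abs_of_nonneg (by positivity), div_lt_iff₀ hn]
    refine hle.trans_lt ?_
    rw [← mul_assoc]
    gcongr
    rw [mul_div_assoc', div_lt_iff₀ (by positivity)]
    linarith
  refine hinj (π x) ha (squeeze_zero (fun k => by positivity) (fun k => ?_)
    (by simpa using (happrox x).add hxX))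
  rw [← add_div]
  gcongr
  norm_cast
  simpa using Matrix.rank_add_le_rank_add_rank (φ (π x) k - evalPoly x (X k)) (evalPoly x (X k))
end
end

section
/- Compression lemma: let F be a field, ε > 0, and let A_1,…,A_d ∈ M_n(F) and B_1,…,B_d ∈ M_{n'}(F) be matrices with n' > (1 + εd)n and Rank(Â_i − B̂_i) < εn for all 1 ≤ i ≤ d. Then there exists an invertible matrix E ∈ GL_{n'}(F) such that E^{-1}(A_i ⊕ 0_{n'−n})E = A_i ⊕ 0_{n'−n} for all 1 ≤ i ≤ d (where A_i ⊕ 0_{n'−n} denotes the n'×n' matrix with A_i in the top-left n×n block and zeros elsewhere), and such that the last n' − ⌊(1 + εd)n⌋ columns of E^{-1}B_iE are zero for all 1 ≤ i ≤ d. -/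
open Matrix

noncomputable section

/-- Any linearly independent finite family can be moved to any other one by an automorphism. -/
theorem exists_linearEquiv_apply_eq {K V ι : Type*} [Field K] [AddCommGroup V] [Module K V]
    [Finite ι] {v w : ι → V} (hv : LinearIndependent K v) (hw : LinearIndependent K w) :
    ∃ g : V ≃ₗ[K] V, ∀ i, g (v i) = w i := by
  have : FiniteDimensional K (Submodule.span K (Set.range v)) :=
    FiniteDimensional.span_of_finite K (Set.finite_range v)
  obtain ⟨g, hg⟩ := Submodule.exists_linearEquiv_restrict_eq
    ((Module.Basis.span hv).equiv (Module.Basis.span hw) (Equiv.refl ι))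
  refine ⟨g, fun i => ?_⟩
  have h := hg (Module.Basis.span hv i)
  rw [Module.Basis.equiv_apply, Module.Basis.span_apply, Module.Basis.span_apply] at h
  exact h.symm

theorem exists_linearEquiv_apply_mem {K V ι : Type*} [Field K] [AddCommGroup V] [Module K V]
    {v : ι → V} (hv : LinearIndependent K v) (s : Finset ι) (W : Submodule K V)
    (hs : s.card ≤ Module.finrank K W) :
    ∃ g : V ≃ₗ[K] V, ∀ i ∈ s, g (v i) ∈ W := by
  obtain ⟨w, hw⟩ := exists_linearIndependent_of_le_finrank hs
  obtain ⟨g, hg⟩ := exists_linearEquiv_apply_eq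
    (hv.comp (fun i : s => (i : ι)) Subtype.val_injective)
    ((hw.map' W.subtype W.ker_subtype).comp s.equivFin s.equivFin.injective)
  refine ⟨g, fun i hi => ?_⟩
  have h := hg ⟨i, hi⟩
  simp only [Function.comp_apply] at h
  rw [h]
  exact (w _).2

theorem finrank_le_finrank_iInf_ker_add_sum {K V V' ι : Type*} [Field K] [AddCommGroup V]
    [Module K V] [FiniteDimensional K V] [AddCommGroup V'] [Module K V'] [Fintype ι]
    (f : ι → V →ₗ[K] V') :
    Module.finrank K V ≤ Module.finrank K (⨅ i, LinearMap.ker (f i) : Submodule K V) +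
      ∑ i, Module.finrank K (LinearMap.range (f i)) := by
  let g := LinearMap.pi fun i => (f i).rangeRestrict
  have hker : LinearMap.ker g = ⨅ i, LinearMap.ker (f i) := by
    simp [g, LinearMap.ker_pi]
  rw [← hker, ← g.finrank_range_add_finrank_ker, add_comm, ← Module.finrank_pi_fintype]
  exact Nat.add_le_add_left (Submodule.finrank_le _) _

theorem padTo_add {F : Type} [Zero F] {n : ℕ} (m : ℕ) (A : Matrix (Fin n) (Fin n) F) :
    padTo (n + m) A = reindex finSumFinEquiv finSumFinEquiv (fromBlocks A 0 0 0) := by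
  ext i j
  refine Fin.addCases (fun i => ?_) (fun i => ?_) i <;>
    refine Fin.addCases (fun j => ?_) (fun j => ?_) j <;> simp [padTo]

theorem padTo_self {F : Type} [Zero F] {n : ℕ} (A : Matrix (Fin n) (Fin n) F) :
    padTo n A = A := by
  ext i j
  simp [padTo]

theorem padRankDiff_eq_rank_sub {F : Type} [Field F] {n n' : ℕ} (h : n ≤ n')
    (A : Matrix (Fin n) (Fin n) F) (B : Matrix (Fin n') (Fin n') F) :
    padRankDiff A B = (padTo n' A - B).rank := by
  rw [padRankDiff, max_eq_right h, padTo_self]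

theorem rank_submatrix_natAdd_le_padRankDiff {F : Type} [Field F] {n m : ℕ}
    (A : Matrix (Fin n) (Fin n) F) (B : Matrix (Fin (n + m)) (Fin (n + m)) F) :
    (B.submatrix id (Fin.natAdd n)).rank ≤ padRankDiff A B := by
  have h : B.submatrix id (Fin.natAdd n) =
      (B - padTo (n + m) A).submatrix id (Fin.natAdd n) := by
    ext i j
    simp [padTo]
  rw [padRankDiff_eq_rank_sub (Nat.le_add_right n m), h]
  refine (rank_submatrix_le _ _ _).trans_eq ?_
  rw [← neg_sub, ← neg_one_smul F, rank_smul_of_mem_nonZeroDivisors]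
  simp

/-- The block diagonal matrix `1 ⊕ g` in `GL_{n+m}(F)`. -/
def blockGL {F : Type} [Field F] (n : ℕ) {m : ℕ} (g : (Fin m → F) ≃ₗ[F] (Fin m → F)) :
    GL (Fin (n + m)) F :=
  Units.map (reindexAlgEquiv F F finSumFinEquiv).toAlgHom.toMonoidHom
    { val := fromBlocks 1 0 0 (LinearMap.toMatrix' g.toLinearMap)
      inv := fromBlocks 1 0 0 (LinearMap.toMatrix' g.symm.toLinearMap)
      val_inv := by simp [fromBlocks_multiply, ← LinearMap.toMatrix'_comp]
      inv_val := by simp [fromBlocks_multiply, ← LinearMap.toMatrix'_comp] }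

theorem coe_blockGL {F : Type} [Field F] (n : ℕ) {m : ℕ}
    (g : (Fin m → F) ≃ₗ[F] (Fin m → F)) :
    (blockGL n g : Matrix (Fin (n + m)) (Fin (n + m)) F) =
      reindexAlgEquiv F F finSumFinEquiv
        (fromBlocks 1 0 0 (LinearMap.toMatrix' g.toLinearMap)) := rfl

theorem padTo_mul_blockGL {F : Type} [Field F] {n m : ℕ} (A : Matrix (Fin n) (Fin n) F)
    (g : (Fin m → F) ≃ₗ[F] (Fin m → F)) :
    padTo (n + m) A * (blockGL n g : Matrix (Fin (n + m)) (Fin (n + m)) F) =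
      (blockGL n g : Matrix (Fin (n + m)) (Fin (n + m)) F) * padTo (n + m) A := by
  rw [padTo_add, coe_blockGL, ← coe_reindexAlgEquiv F F, ← map_mul, ← map_mul]
  simp [fromBlocks_multiply]

theorem mul_blockGL_apply_natAdd {F : Type} [Field F] {n m : ℕ}
    (B : Matrix (Fin (n + m)) (Fin (n + m)) F) (g : (Fin m → F) ≃ₗ[F] (Fin m → F))
    (i : Fin (n + m)) (j : Fin m) :
    (B * (blockGL n g : Matrix (Fin (n + m)) (Fin (n + m)) F)) i (Fin.natAdd n j) =
      (B.submatrix id (Fin.natAdd n) *ᵥ g (Pi.single j 1)) i := by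
  simp [coe_blockGL, mul_apply, Fin.sum_univ_add, mulVec, dotProduct, LinearMap.toMatrix'_apply]

/-- **Compression lemma.** If `n' > (1 + εd)n` and `Rank(Â_i − B̂_i) < εn` for all `i`, then
there is an invertible `E ∈ GL_{n'}(F)` fixing each `A_i ⊕ 0` under conjugation and such
that the last `n' − ⌊(1 + εd)n⌋` columns of each `E⁻¹B_iE` vanish. -/
theorem stmt10_compression_lemma
    (F : Type) [Field F] (d n n' : ℕ) (ε : ℝ) (hε : 0 < ε)
    (A : Fin d → Matrix (Fin n) (Fin n) F)
    (B : Fin d → Matrix (Fin n') (Fin n') F)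
    (hn' : (1 + ε * d) * n < (n' : ℝ))
    (happrox : ∀ i, ((padRankDiff (A i) (B i) : ℝ) < ε * n)) :
    ∃ E : GL (Fin n') F,
      (∀ i, (↑E⁻¹ : Matrix (Fin n') (Fin n') F) * padTo n' (A i) * (↑E : Matrix (Fin n') (Fin n') F)
          = padTo n' (A i)) ∧
      (∀ i, ∀ j : Fin n', Nat.floor ((1 + ε * d) * n) ≤ (j : ℕ) →
        ∀ i' : Fin n',
          ((↑E⁻¹ : Matrix (Fin n') (Fin n') F) * B i * (↑E : Matrix (Fin n') (Fin n') F)) i' j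
            = 0) := by
  obtain ⟨m, rfl⟩ : ∃ m, n' = n + m := by
    refine Nat.exists_eq_add_of_le ?_
    have : (0 : ℝ) ≤ ε * d * n := by positivity
    exact_mod_cast (by linarith : (n : ℝ) ≤ n')
  set c := ⌊(1 + ε * d) * n⌋₊ with hc
  have hrank : n + ∑ i, padRankDiff (A i) (B i) ≤ c := by
    refine Nat.le_floor ?_
    have h := Finset.sum_le_sum fun i (_ : i ∈ Finset.univ) => (happrox i).le
    simp only [Finset.sum_const, Finset.card_univ, Fintype.card_fin, nsmul_eq_mul] at h
    push_cast
    linarith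
  have hcm : c < n + m := (Nat.floor_lt (by positivity)).2 hn'
  let N i := (B i).submatrix id (Fin.natAdd n)
  let W : Submodule F (Fin m → F) := ⨅ i, LinearMap.ker (N i).mulVecLin
  have hW : n + m ≤ c + Module.finrank F W := by
    have h := finrank_le_finrank_iInf_ker_add_sum fun i => (N i).mulVecLin
    have hsum : ∑ i, Module.finrank F (LinearMap.range (N i).mulVecLin) ≤
        ∑ i, padRankDiff (A i) (B i) :=
      Finset.sum_le_sum fun i _ => rank_submatrix_natAdd_le_padRankDiff (A i) (B i)
    rw [Module.finrank_fin_fun] at h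
    change m ≤ Module.finrank F W + _ at h
    omega
  obtain ⟨g, hg⟩ := exists_linearEquiv_apply_mem (Pi.basisFun F (Fin m)).linearIndependent
    (Finset.Ici (⟨c - n, by omega⟩ : Fin m)) W (by rw [Fin.card_Ici]; dsimp only; omega)
  refine ⟨blockGL n g, fun i => ?_, fun i j hj i' => ?_⟩
  · rw [mul_assoc, padTo_mul_blockGL, Units.inv_mul_cancel_left]
  · obtain ⟨k, rfl⟩ : ∃ k, j = Fin.natAdd n k :=
      ⟨⟨j - n, by omega⟩, Fin.ext (by simp only [Fin.natAdd_mk]; omega)⟩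
    have hk : N i *ᵥ g (Pi.single k 1) = 0 := by
      have h := hg k (by
        rw [Finset.mem_Ici, Fin.le_def]
        simp only [Fin.val_natAdd] at hj
        dsimp only
        omega)
      rw [Pi.basisFun_apply] at h
      exact (Submodule.mem_iInf _).1 h i
    rw [mul_assoc, mul_apply]
    refine Finset.sum_eq_zero fun l _ => ?_
    rw [mul_blockGL_apply_natAdd]
    change _ * (N i *ᵥ _) l = 0
    rw [hk, Pi.zero_apply, mul_zero]
end
end

section
/- Approximation by idempotents: let F be a field, λ ≥ 0, and let C ∈ M_n(F) be a matrix with rank(C² − C) ≤ λ (normalized rank). Then there exists a matrix E ∈ M_n(F) with E² = E and rank(E − C) ≤ λ. -/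
open Matrix

noncomputable section

/-- Every endomorphism of a vector space has a generalized inverse. -/
theorem LinearMap.exists_generalized_inverse {K V : Type*} [Field K] [AddCommGroup V] [Module K V]
    (f : Module.End K V) : ∃ g : Module.End K V, f * g * f = f := by
  obtain ⟨s, hs⟩ := f.rangeRestrict.exists_rightInverse_of_surjective f.range_rangeRestrict
  obtain ⟨g, hg⟩ := LinearMap.exists_extend s
  refine ⟨g, LinearMap.ext fun v => ?_⟩
  have h₁ : g (f v) = s (f.rangeRestrict v) := LinearMap.congr_fun hg (f.rangeRestrict v)
  have h₂ : f.rangeRestrict (s (f.rangeRestrict v)) = f.rangeRestrict v :=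
    LinearMap.congr_fun hs (f.rangeRestrict v)
  rw [Module.End.mul_apply, Module.End.mul_apply, h₁]
  exact congrArg Subtype.val h₂

/-- Every square matrix over a field has a generalized inverse. -/
theorem Matrix.exists_generalized_inverse {K ι : Type*} [Field K] [Fintype ι] [DecidableEq ι]
    (A : Matrix ι ι K) : ∃ X : Matrix ι ι K, A * X * A = A := by
  obtain ⟨g, hg⟩ := LinearMap.exists_generalized_inverse (Matrix.toLinAlgEquiv' A)
  refine ⟨Matrix.toLinAlgEquiv'.symm g, Matrix.toLinAlgEquiv'.injective ?_⟩
  rw [map_mul, map_mul, AlgEquiv.apply_symm_apply, hg]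

/-- A square matrix `C` differs from some idempotent by a matrix of rank at most that of
`C * C - C`. -/
theorem Matrix.exists_idempotent_rank_sub_le {K ι : Type*} [Field K] [Fintype ι] [DecidableEq ι]
    (C : Matrix ι ι K) : ∃ E : Matrix ι ι K, E * E = E ∧ (E - C).rank ≤ (C * C - C).rank := by
  obtain ⟨X, hX⟩ := (C * C - C).exists_generalized_inverse
  set N := C * C - C with hN
  have hNP : N * (1 - X * N) = 0 := by
    rw [mul_sub, mul_one, ← mul_assoc, hX, sub_self]
  have hNC : N * C = C * N := by rw [hN]; noncomm_ring
  have hCCP : C * (C * (1 - X * N)) = C * (1 - X * N) := by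
    rw [← sub_eq_zero, ← mul_assoc, ← sub_mul, ← hN, hNP]
  have hPCP : (1 - X * N) * (C * (1 - X * N)) = C * (1 - X * N) := by
    rw [sub_mul 1, one_mul, mul_assoc X, ← mul_assoc N, hNC, mul_assoc C, hNP, mul_zero, mul_zero,
      sub_zero]
  refine ⟨C * (1 - X * N), by rw [mul_assoc, hPCP, hCCP], ?_⟩
  have hE : C * (1 - X * N) - C = -(C * X) * N := by noncomm_ring
  rw [hE]
  exact Matrix.rank_mul_le_right _ _

/-- **Approximation by idempotents.** If `C ∈ M_n(F)` satisfies `rank(C² − C) ≤ λ`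
(normalized rank, i.e. `Rank(C² − C) ≤ λn`), then there is an idempotent `E ∈ M_n(F)` with
`rank(E − C) ≤ λ`. -/
theorem stmt13_idempotent_approximation
    (F : Type) [Field F] (n : ℕ) (lam : ℝ) (hlam : 0 ≤ lam)
    (C : Matrix (Fin n) (Fin n) F)
    (h : ((C * C - C).rank : ℝ) ≤ lam * n) :
    ∃ E : Matrix (Fin n) (Fin n) F, E * E = E ∧ ((E - C).rank : ℝ) ≤ lam * n := by
  obtain ⟨E, hE, hr⟩ := C.exists_idempotent_rank_sub_le
  exact ⟨E, hE, (Nat.cast_le.mpr hr).trans h⟩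
end
end

section
/- Rank-stability of ℂ[x]/(p(x)), quantitative form: let p(x) ∈ ℂ[x] be a non-constant polynomial and let M ∈ M_n(ℂ). Then there exists a matrix B ∈ M_n(ℂ) with p(B) = 0 and Rank(M − B) ≤ Rank(p(M)). -/
namespace Module.End

open Polynomial

/-- Two endomorphisms that agree on a submodule invariant under one of them have the same
polynomial values there. -/
theorem aeval_apply_eq_of_eqOn {R V : Type*} [CommRing R] [AddCommGroup V] [Module R V]
    {f g : Module.End R V} {W : Submodule R V} (hW : ∀ w ∈ W, f w ∈ W)
    (hfg : ∀ w ∈ W, g w = f w) (p : R[X]) {w : V} (hw : w ∈ W) :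
    aeval g p w = aeval f p w := by
  have hpow (k : ℕ) : ∀ w ∈ W, (g ^ k) w = (f ^ k) w := by
    induction k with
    | zero => simp
    | succ k ih =>
      intro w hw
      rw [pow_succ, pow_succ, mul_apply, mul_apply, hfg w hw, ih _ (hW w hw)]
  simp [aeval_eq_sum_range, LinearMap.sum_apply, hpow _ w hw]

/-- If `p` has a root, every endomorphism `f` agrees on `ker (p(f))` with some endomorphism
annihilated by `p`. -/
theorem exists_aeval_eq_zero_and_ker_le {K V : Type*} [Field K] [AddCommGroup V] [Module K V]
    (f : Module.End K V) {p : K[X]} {r : K} (hr : p.IsRoot r) :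
    ∃ g : Module.End K V, aeval g p = 0 ∧ LinearMap.ker (aeval f p) ≤ LinearMap.ker (f - g) := by
  set W := LinearMap.ker (aeval f p) with hWdef
  obtain ⟨π, hπ⟩ := W.subtype.exists_leftInverse_of_injective W.ker_subtype
  have hπW : ∀ w (hw : w ∈ W), π w = ⟨w, hw⟩ := fun w hw => LinearMap.congr_fun hπ ⟨w, hw⟩
  have hfW : ∀ w ∈ W, f w ∈ W := by
    intro w hw
    rw [hWdef, LinearMap.mem_ker] at hw ⊢
    have hcomm : aeval f p * f = f * aeval f p := by
      simpa using congrArg (aeval f) (mul_comm p X)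
    rw [← mul_apply, hcomm, mul_apply, hw, map_zero]
  let P : Module.End K V := W.subtype ∘ₗ π
  let g : Module.End K V := f * P + r • (1 - P)
  have hgW : ∀ w ∈ W, g w = f w := by
    intro w hw
    simp [g, P, hπW w hw]
  have hgker : ∀ c ∈ LinearMap.ker π, g c = algebraMap K (Module.End K V) r c := by
    intro c hc
    simp [g, P, LinearMap.mem_ker.mp hc]
  refine ⟨g, LinearMap.ext fun x => ?_, fun w hw => by simp [hgW w hw]⟩
  have hx : x - π x ∈ LinearMap.ker π := by
    simp [hπW _ (π x).2]
  have h₁ : aeval g p (π x : V) = 0 :=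
    (aeval_apply_eq_of_eqOn hfW hgW p (π x).2).trans (π x).2
  have h₂ : aeval g p (x - π x) = 0 := by
    rw [aeval_apply_eq_of_eqOn (fun c hc => by simpa using Or.inr hc) hgker p hx,
      aeval_algebraMap_apply, coe_aeval_eq_eval, hr.eq_zero, map_zero, LinearMap.zero_apply]
  rw [← sub_add_cancel x (π x : V), map_add, h₁, h₂, add_zero, LinearMap.zero_apply]

end Module.End

theorem LinearMap.finrank_range_le_of_ker_le {K V V₁ V₂ : Type*} [Field K]
    [AddCommGroup V] [Module K V] [FiniteDimensional K V] [AddCommGroup V₁] [Module K V₁]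
    [AddCommGroup V₂] [Module K V₂] {f : V →ₗ[K] V₁} {g : V →ₗ[K] V₂}
    (h : LinearMap.ker f ≤ LinearMap.ker g) :
    Module.finrank K (LinearMap.range g) ≤ Module.finrank K (LinearMap.range f) := by
  have hf := f.finrank_range_add_finrank_ker
  have hg := g.finrank_range_add_finrank_ker
  have hle := Submodule.finrank_mono h
  omega


/-- **Rank-stability of `ℂ[x]/(p(x))`, quantitative form.** For any non-constant polynomial
`p ∈ ℂ[x]` and any `M ∈ M_n(ℂ)` there is `B ∈ M_n(ℂ)` with `p(B) = 0` and
`Rank(M − B) ≤ Rank(p(M))`. -/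
theorem stmt16_polynomial_quotient_quantitative
    (n : ℕ) (p : Polynomial ℂ) (hp : 0 < p.natDegree)
    (M : Matrix (Fin n) (Fin n) ℂ) :
    ∃ B : Matrix (Fin n) (Fin n) ℂ,
      Polynomial.aeval B p = 0 ∧ (M - B).rank ≤ (Polynomial.aeval M p).rank := by
  obtain ⟨r, hr⟩ := IsAlgClosed.exists_root p
    (Polynomial.natDegree_pos_iff_degree_pos.mp hp).ne'
  let e : Matrix (Fin n) (Fin n) ℂ ≃ₐ[ℂ] Module.End ℂ (Fin n → ℂ) := Matrix.toLinAlgEquiv'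
  obtain ⟨g, hg, hker⟩ := Module.End.exists_aeval_eq_zero_and_ker_le (e M) hr
  refine ⟨e.symm g, by rw [Polynomial.aeval_algHom_apply, hg, map_zero], ?_⟩
  have hrank (A : Matrix (Fin n) (Fin n) ℂ) :
      A.rank = Module.finrank ℂ (LinearMap.range (e A)) := rfl
  rw [hrank, hrank, map_sub, e.apply_symm_apply, ← Polynomial.aeval_algHom_apply]
  exact LinearMap.finrank_range_le_of_ker_le hker
end

section
/- The first Weyl algebra, presented as ℂ⟨x,y⟩/⟨xy − yx − 1⟩, is not rank-stable. In particular, for every n ≥ 1 there exist X, Y ∈ M_n(ℂ) with Rank(XY − YX − I_n) ≤ 1 (so rank(XY − YX − I_n) ≤ 1/n), while there are no matrices B_1, B_2 ∈ M_{n'}(ℂ) for any n' ≥ 1 with B_1B_2 − B_2B_1 = I_{n'}. -/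
open Matrix

noncomputable section

/-- The derivative `d/dt` on polynomials in `t` of degree `< n`, in the monomial basis. -/
def derivMatrix (F : Type*) [Field F] (n : ℕ) : Matrix (Fin n) (Fin n) F :=
  Matrix.of fun i j => if (j : ℕ) = i + 1 then (j : F) else 0

/-- Multiplication by `t`, truncated to polynomials of degree `< n`, in the monomial basis. -/
def mulVarMatrix (F : Type*) [Field F] (n : ℕ) : Matrix (Fin n) (Fin n) F :=
  Matrix.of fun i j => if (i : ℕ) = j + 1 then 1 else 0

theorem derivMatrix_mul_mulVarMatrix (F : Type*) [Field F] (n : ℕ) :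
    derivMatrix F n * mulVarMatrix F n =
      diagonal fun i : Fin n => if (i : ℕ) + 1 < n then (i : F) + 1 else 0 := by
  ext i j
  simp only [mul_apply, derivMatrix, mulVarMatrix, of_apply, diagonal_apply]
  by_cases hi : (i : ℕ) + 1 < n
  · rw [Finset.sum_eq_single (⟨i + 1, hi⟩ : Fin n)]
    · simp [hi, Fin.ext_iff]
    · intro k _ hk
      rw [if_neg (fun h => hk (Fin.ext h)), zero_mul]
    · simp
  · rw [if_neg hi, ite_self]
    refine Finset.sum_eq_zero fun k _ => ?_
    rw [if_neg (by omega), zero_mul]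

theorem mulVarMatrix_mul_derivMatrix (F : Type*) [Field F] (n : ℕ) :
    mulVarMatrix F n * derivMatrix F n = diagonal fun i : Fin n => (i : F) := by
  ext i j
  simp only [mul_apply, derivMatrix, mulVarMatrix, of_apply, diagonal_apply]
  by_cases hi : (i : ℕ) = 0
  · have : (if i = j then ((i : ℕ) : F) else 0) = 0 := by simp [hi]
    rw [this]
    refine Finset.sum_eq_zero fun k _ => ?_
    rw [if_neg (by omega), zero_mul]
  · rw [Finset.sum_eq_single (⟨i - 1, by omega⟩ : Fin n)]
    · have h : (i : ℕ) - 1 + 1 = i := by omega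
      by_cases hij : i = j
      · subst hij
        simp [h]
      · have hji : (j : ℕ) ≠ i := fun e => hij (Fin.ext e.symm)
        simp [h, hij, hji]
    · intro k _ hk
      rw [if_neg (fun h => hk (Fin.ext (by simp; omega))), zero_mul]
    · simp

theorem rank_weyl_relation_derivMatrix_mulVarMatrix_le (F : Type*) [Field F] (n : ℕ) :
    (derivMatrix F n * mulVarMatrix F n - mulVarMatrix F n * derivMatrix F n - 1).rank ≤ 1 := by
  have h : derivMatrix F n * mulVarMatrix F n - mulVarMatrix F n * derivMatrix F n - 1 =
      vecMulVec (fun i : Fin n => if (i : ℕ) + 1 = n then -(n : F) else 0)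
        (fun j : Fin n => if (j : ℕ) + 1 = n then 1 else 0) := by
    rw [derivMatrix_mul_mulVarMatrix, mulVarMatrix_mul_derivMatrix]
    ext i j
    simp only [Matrix.sub_apply, diagonal_apply, one_apply, vecMulVec_apply]
    by_cases hij : i = j
    · subst hij
      by_cases hi : (i : ℕ) + 1 = n
      · have hcast : (n : F) = (i : F) + 1 := by exact_mod_cast congrArg (Nat.cast (R := F)) hi.symm
        simp only [hi, lt_irrefl, if_true, if_false, hcast]
        ring
      · have hlt : (i : ℕ) + 1 < n := by omega
        simp [hi, hlt]
    · by_cases hi : (i : ℕ) + 1 = n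
      · have hj : ¬ (j : ℕ) + 1 = n := fun hj => hij (Fin.ext (by omega))
        simp [hij, hj]
      · simp [hij, hi]
  rw [h]
  exact rank_vecMulVec_le _ _

theorem mul_sub_mul_ne_one {ι F : Type*} [Fintype ι] [DecidableEq ι] [Nonempty ι] [Field F]
    [CharZero F] (A B : Matrix ι ι F) : A * B - B * A ≠ 1 := by
  intro h
  have ht := congrArg trace h
  rw [trace_sub, trace_mul_comm, sub_self, trace_one] at ht
  exact Fintype.card_ne_zero (Nat.cast_eq_zero.mp ht.symm)

/-- **The first Weyl algebra `ℂ⟨x,y⟩/⟨xy − yx − 1⟩` is not rank-stable.** Moreover, for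
every `n ≥ 1` there are `X, Y ∈ M_n(ℂ)` with `Rank(XY − YX − I_n) ≤ 1`, while no matrices
`B₁, B₂ ∈ M_{n'}(ℂ)` (for any `n' ≥ 1`) satisfy `B₁B₂ − B₂B₁ = I_{n'}`. -/
theorem stmt19_weyl_algebra_not_rank_stable :
    ¬ RankStable ℂ (fun _ : Fin 1 =>
        FreeAlgebra.ι ℂ (0 : Fin 2) * FreeAlgebra.ι ℂ (1 : Fin 2)
          - FreeAlgebra.ι ℂ (1 : Fin 2) * FreeAlgebra.ι ℂ (0 : Fin 2) - 1) ∧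
    (∀ n : ℕ, 1 ≤ n → ∃ X Y : Matrix (Fin n) (Fin n) ℂ,
      (X * Y - Y * X - 1).rank ≤ 1) ∧
    (∀ n' : ℕ, 1 ≤ n' → ∀ B₁ B₂ : Matrix (Fin n') (Fin n') ℂ,
      B₁ * B₂ - B₂ * B₁ ≠ 1) := by
  refine ⟨fun hstable => ?_,
    fun n _ => ⟨_, _, rank_weyl_relation_derivMatrix_mulVarMatrix_le ℂ n⟩,
    fun n' hn' B₁ B₂ => ?_⟩
  · obtain ⟨δ, hδ, h⟩ := hstable 1 one_pos
    obtain ⟨n, hn⟩ := exists_nat_gt (1 / δ)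
    have hn0 : 0 < n := by
      have : (0 : ℝ) < n := (by positivity : 0 < 1 / δ).trans hn
      exact_mod_cast this
    obtain ⟨n', hn', B, hB, -⟩ := h n hn0 ![derivMatrix ℂ n, mulVarMatrix ℂ n] fun _ => by
      have hrank : ((derivMatrix ℂ n * mulVarMatrix ℂ n - mulVarMatrix ℂ n * derivMatrix ℂ n
          - 1).rank : ℝ) ≤ 1 := by
        exact_mod_cast rank_weyl_relation_derivMatrix_mulVarMatrix_le ℂ n
      have hδn : 1 < δ * n := by rwa [div_lt_iff₀' hδ] at hn
      simpa [evalPoly] using hrank.trans_lt hδn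
    have : Nonempty (Fin n') := ⟨⟨0, hn'⟩⟩
    exact mul_sub_mul_ne_one (B 0) (B 1) (sub_eq_zero.mp (by simpa [evalPoly] using hB 0))
  · have : Nonempty (Fin n') := ⟨⟨0, hn'⟩⟩
    exact mul_sub_mul_ne_one B₁ B₂
end
end
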